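/- (Proposition 3, inequality (22)) Let d ≥ 2, n = d+1, and fix nonnegative integers ℓ₁, ℓ₂ with ℓ := ℓ₁+ℓ₂ < d. For any symmetrical code that satisfies node regeneration, message recovery (for parameter ℓ), and repair secrecy (for parameters ℓ₁, ℓ₂), and for every m ∈ [ℓ+1:d−1], one has H(U^{(ℓ₁+1,m)}) + ((d−m)/(d−ℓ)) · H(U^{(ℓ₁,ℓ+1)}) ≥ (d−m) · Σ_{j=ℓ+1}^{m} T_{d,j,ℓ}^{−1} B_j + H(U^{(ℓ₁+1,m+1)}) + ((d−m)/(d−ℓ)) · H(U^{(ℓ₁,ℓ)}). -/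

import Mathlib

open scoped BigOperators Classical

namespace MDCSR

noncomputable section

/-- `X` is a deterministic function of `Y`. -/
def IsFuncOf {Ω α β : Type*} (X : Ω → α) (Y : Ω → β) : Prop :=
  ∃ f : β → α, ∀ ω, X ω = f (Y ω)

variable {Ω V : Type} [Fintype Ω]

/-- Probability of the event `X = x` under the probability mass function `p`. -/
def pm (p : Ω → ℝ) {α : Type*} (X : Ω → α) (x : α) : ℝ :=
  ∑ ω ∈ Finset.univ.filter (fun ω' => X ω' = x), p ω

/-- Shannon entropy of the random variable `X` under the probability mass function `p`. -/
def H (p : Ω → ℝ) {α : Type*} (X : Ω → α) : ℝ :=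
  -∑ ω, p ω * Real.log (pm p X (X ω))

/-- An `(n = d+1, d)` code: messages `M 1, …, M d`, a key `K`, node contents
`W 1, …, W (d+1)`, and repair data `S i j` (data downloaded from node `i` to repair
node `j`), all random variables on a common finite probability space `(Ω, p)`.
The messages are mutually independent, the key is independent of the messages,
each `W i` is a deterministic function of the messages and the key, and each
`S i j` is a deterministic function of `W i`. -/
structure Code (Ω V : Type) [Fintype Ω] (d : ℕ) : Type where
  p : Ω → ℝ
  p_nonneg : ∀ ω, 0 ≤ p ω
  p_sum : ∑ ω, p ω = 1
  M : ℕ → Ω → V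
  K : Ω → V
  W : ℕ → Ω → V
  S : ℕ → ℕ → Ω → V
  M_indep : ∀ x : ℕ → V,
    pm p (fun ω (i : Fin d) => M (↑i + 1) ω) (fun i => x (↑i + 1)) =
      ∏ i ∈ Finset.Icc 1 d, pm p (M i) (x i)
  K_indep : ∀ (k : V) (x : ℕ → V),
    pm p (fun ω => (K ω, fun (i : Fin d) => M (↑i + 1) ω)) (k, fun i => x (↑i + 1)) =
      pm p K k * pm p (fun ω (i : Fin d) => M (↑i + 1) ω) (fun i => x (↑i + 1))
  W_func : ∀ i ∈ Finset.Icc 1 (d + 1),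
    IsFuncOf (W i) (fun ω => ((fun (j : Fin d) => M (↑j + 1) ω), K ω))
  S_func : ∀ i ∈ Finset.Icc 1 (d + 1), ∀ j ∈ Finset.Icc 1 (d + 1), i ≠ j →
    IsFuncOf (S i j) (W i)

/-- Descriptors for the basic random variables of a code. -/
inductive Atom where
  | M : ℕ → Atom
  | K : Atom
  | W : ℕ → Atom
  | S : ℕ → ℕ → Atom

variable {d : ℕ}

/-- The random variable described by an atom. -/
def Code.atomRV (C : Code Ω V d) : Atom → Ω → V
  | .M i => C.M i
  | .K => C.K
  | .W i => C.W i
  | .S i j => C.S i j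

/-- The joint random variable (tuple) described by a list of atoms. -/
def Code.rv (C : Code Ω V d) (L : List Atom) : Ω → List V :=
  fun ω => L.map fun a => C.atomRV a ω

/-- Joint entropy of a tuple of basic random variables. -/
def Code.HL (C : Code Ω V d) (L : List Atom) : ℝ := H C.p (C.rv L)

/-- Conditional entropy `H(L₁ | L₂)`. -/
def Code.CH (C : Code Ω V d) (L₁ L₂ : List Atom) : ℝ := C.HL (L₁ ++ L₂) - C.HL L₂

/-- Mutual information `I(L₁ ; L₂)`. -/
def Code.MI (C : Code Ω V d) (L₁ L₂ : List Atom) : ℝ :=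
  C.HL L₁ + C.HL L₂ - C.HL (L₁ ++ L₂)

/-- Relabeling of an atom along a permutation of the storage-node indices. -/
def Atom.perm (π : Equiv.Perm ℕ) : Atom → Atom
  | .M i => .M i
  | .K => .K
  | .W i => .W (π i)
  | .S i j => .S (π i) (π j)

/-- A code is symmetrical if every joint entropy of a tuple of the basic random
variables is invariant under every permutation of the storage-node indices `[1:n]`. -/
def Code.Symmetrical (C : Code Ω V d) : Prop :=
  ∀ π : Equiv.Perm ℕ, (∀ i ∈ Finset.Icc 1 (d + 1), π i ∈ Finset.Icc 1 (d + 1)) →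
    ∀ L : List Atom, C.HL (L.map (Atom.perm π)) = C.HL L

/-- The list `[a, a+1, …, b]`. -/
def icc (a b : ℕ) : List ℕ := List.range' a (b + 1 - a)

/-- `W_A` as a list of atoms. -/
def Ws (A : List ℕ) : List Atom := A.map Atom.W

/-- `M_A` as a list of atoms. -/
def MsL (A : List ℕ) : List Atom := A.map Atom.M

/-- `M^{(m)} = (M_1, …, M_m)`. -/
def Mup (m : ℕ) : List Atom := MsL (icc 1 m)

/-- `S_{B → j}`. -/
def Sto (B : List ℕ) (j : ℕ) : List Atom := B.map fun i => Atom.S i j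

/-- `S_{i → B}`. -/
def Sfrom (i : ℕ) (B : List ℕ) : List Atom := B.map fun j => Atom.S i j

/-- `S̄_{→ j} = S_{[j+1:n] → j}` (here `n = d+1`). -/
def SbarTo (d j : ℕ) : List Atom := Sto (icc (j + 1) (d + 1)) j

/-- `S̄_{→ A}`. -/
def SbarToL (d : ℕ) (A : List ℕ) : List Atom := (A.map (SbarTo d)).flatten

/-- `S̲_{→ j} = S_{[1:j-1] → j}`. -/
def SunderTo (j : ℕ) : List Atom := Sto (icc 1 (j - 1)) j

/-- `S̲_{→ A}`. -/
def SunderToL (A : List ℕ) : List Atom := (A.map SunderTo).flatten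

/-- `S_{→ j} = S_{([1:n] ∖ {j}) → j}` (here `n = d+1`). -/
def StoFull (d j : ℕ) : List Atom := Sto ((icc 1 (d + 1)).filter (fun i => i ≠ j)) j

/-- `(S_{→ j} : j ∈ A)`. -/
def StoFullL (d : ℕ) (A : List ℕ) : List Atom := (A.map (StoFull d)).flatten

/-- `U^{(t,s)} = (W_{[1:t]}, S̄_{→[t+1:s]})`. -/
def U (d t s : ℕ) : List Atom := Ws (icc 1 t) ++ SbarToL d (icc (t + 1) s)

/-- Node regeneration: each `W j` is a deterministic function of `S_{→ j}`. -/
def Code.NodeRegen (C : Code Ω V d) : Prop :=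
  ∀ j ∈ Finset.Icc 1 (d + 1), IsFuncOf (C.W j) (C.rv (StoFull d j))

/-- Message recovery for parameter `ℓ`: `M j` is constant for `j ∈ [1:ℓ]`, and for every
`A ⊆ [1:n]` with `|A| ∈ [ℓ+1:d]`, `M_{|A|}` is a deterministic function of `W_A`. -/
def Code.MsgRecovery (C : Code Ω V d) (ℓ : ℕ) : Prop :=
  (∀ j ∈ Finset.Icc 1 ℓ, ∃ c : V, ∀ ω, C.M j ω = c) ∧
  ∀ A : Finset ℕ, A ⊆ Finset.Icc 1 (d + 1) → A.card ∈ Finset.Icc (ℓ + 1) d →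
    IsFuncOf (C.M A.card) (C.rv (Ws (A.sort (· ≤ ·))))

/-- Repair secrecy for parameters `ℓ₁, ℓ₂`: for all disjoint `E₁, E₂ ⊆ [1:n]` with
`|E₁| = ℓ₁`, `|E₂| = ℓ₂`, the messages `M_{ℓ+1}, …, M_d` are independent of
`((W_i : i ∈ E₁), (S_{→j} : j ∈ E₂))`, where `ℓ = ℓ₁ + ℓ₂`. -/
def Code.RepairSecrecy (C : Code Ω V d) (ℓ₁ ℓ₂ : ℕ) : Prop :=
  ∀ E₁ E₂ : Finset ℕ, E₁ ⊆ Finset.Icc 1 (d + 1) → E₂ ⊆ Finset.Icc 1 (d + 1) →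
    Disjoint E₁ E₂ → E₁.card = ℓ₁ → E₂.card = ℓ₂ →
    C.MI (MsL (icc (ℓ₁ + ℓ₂ + 1) d))
      (Ws (E₁.sort (· ≤ ·)) ++ StoFullL d (E₂.sort (· ≤ ·))) = 0

/-- `T_{d,k,ℓ} = Σ_{t=ℓ+1}^{k} (d+1−t)`, as a real number. -/
def T (d k ℓ : ℕ) : ℝ := ∑ t ∈ Finset.Icc (ℓ + 1) k, ((d : ℝ) + 1 - (t : ℝ))

section Entropy

variable {p : Ω → ℝ} {α β γ : Type*}

theorem le_pm (h0 : ∀ ω, 0 ≤ p ω) (X : Ω → α) (ω : Ω) : p ω ≤ pm p X (X ω) :=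
  Finset.single_le_sum (f := p) (fun i _ => h0 i) (by simp)

theorem H_le_of_determined (h0 : ∀ ω, 0 ≤ p ω) {X : Ω → α} {Y : Ω → β}
    (h : ∀ ω ω', Y ω = Y ω' → X ω = X ω') : H p X ≤ H p Y := by
  unfold H
  refine neg_le_neg (Finset.sum_le_sum fun ω _ => ?_)
  rcases (h0 ω).eq_or_lt with hω | hω
  · simp [← hω]
  refine mul_le_mul_of_nonneg_left (Real.log_le_log (hω.trans_le (le_pm h0 Y ω)) ?_) (h0 ω)
  refine Finset.sum_le_sum_of_subset_of_nonneg (fun ω' h' => ?_) (fun i _ _ => h0 i)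
  simp only [Finset.mem_filter, Finset.mem_univ, true_and] at h' ⊢
  exact h _ _ h'

theorem sum_pm_ratio_le_one (h0 : ∀ ω, 0 ≤ p ω) (h1 : ∑ ω, p ω = 1)
    {X : Ω → α} {Y : Ω → β} {Z : Ω → γ}
    (hX : ∀ ω ω', X ω = X ω' → Z ω = Z ω') (hY : ∀ ω ω', Y ω = Y ω' → Z ω = Z ω') :
    ∑ ω, p ω * (pm p X (X ω) * pm p Y (Y ω) /
      (pm p (fun ω => (X ω, Y ω)) (X ω, Y ω) * pm p Z (Z ω))) ≤ 1 := by
  set q := pm p (fun ω => (X ω, Y ω)) with hq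
  have expand : ∀ ω, p ω * (pm p X (X ω) * pm p Y (Y ω) / (q (X ω, Y ω) * pm p Z (Z ω))) =
      ∑ a, ∑ b, if X ω = X a ∧ Y ω = Y b then
        p ω * (p a * p b / (q (X ω, Y ω) * pm p Z (Z ω))) else 0 := by
    intro ω
    rw [pm, pm, Finset.sum_filter, Finset.sum_filter, Finset.sum_mul_sum, Finset.sum_div,
      Finset.mul_sum]
    refine Finset.sum_congr rfl fun a _ => ?_
    rw [Finset.sum_div, Finset.mul_sum]
    refine Finset.sum_congr rfl fun b _ => ?_
    rw [eq_comm (a := X ω), eq_comm (a := Y ω)]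
    by_cases ha : X a = X ω <;> by_cases hb : Y b = Y ω <;> simp [ha, hb]
  have inner : ∀ a b, (∑ ω, if X ω = X a ∧ Y ω = Y b then
        p ω * (p a * p b / (q (X ω, Y ω) * pm p Z (Z ω))) else 0) ≤
      if Z b = Z a then p a * (p b / pm p Z (Z a)) else 0 := by
    intro a b
    by_cases hz : Z b = Z a
    · have hsum : (∑ ω, if X ω = X a ∧ Y ω = Y b then
          p ω * (p a * p b / (q (X ω, Y ω) * pm p Z (Z ω))) else 0) =
          q (X a, Y b) * (p a * p b / (q (X a, Y b) * pm p Z (Z a))) := by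
        have hqab : q (X a, Y b) = ∑ ω, if X ω = X a ∧ Y ω = Y b then p ω else 0 := by
          rw [hq, pm, Finset.sum_filter]
          simp
        trans (∑ ω, if X ω = X a ∧ Y ω = Y b then p ω else 0) *
          (p a * p b / (q (X a, Y b) * pm p Z (Z a)))
        swap
        · rw [← hqab]
        rw [Finset.sum_mul]
        refine Finset.sum_congr rfl fun ω _ => ?_
        by_cases h : X ω = X a ∧ Y ω = Y b
        · simp [h.1, h.2, hX _ _ h.1]
        · simp [h]
      rw [hsum, if_pos hz]
      have hpos : 0 ≤ p a * (p b / pm p Z (Z a)) :=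
        mul_nonneg (h0 a) (div_nonneg (h0 b) ((h0 a).trans (le_pm h0 Z a)))
      by_cases hq0 : q (X a, Y b) = 0
      · simpa [hq0] using hpos
      · exact le_of_eq (by field_simp)
    · rw [if_neg hz]
      refine le_of_eq (Finset.sum_eq_zero fun ω _ => if_neg fun h => hz ?_)
      rw [← hX _ _ h.1, ← hY _ _ h.2]
  calc _ = ∑ ω, ∑ a, ∑ b, (if X ω = X a ∧ Y ω = Y b then
        p ω * (p a * p b / (q (X ω, Y ω) * pm p Z (Z ω))) else 0) :=
        Finset.sum_congr rfl fun ω _ => expand ω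
    _ = ∑ a, ∑ b, ∑ ω, (if X ω = X a ∧ Y ω = Y b then
        p ω * (p a * p b / (q (X ω, Y ω) * pm p Z (Z ω))) else 0) := by
        rw [Finset.sum_comm]
        exact Finset.sum_congr rfl fun a _ => Finset.sum_comm
    _ ≤ ∑ a, ∑ b, (if Z b = Z a then p a * (p b / pm p Z (Z a)) else 0) :=
        Finset.sum_le_sum fun a _ => Finset.sum_le_sum fun b _ => inner a b
    _ ≤ ∑ a, p a := by
        refine Finset.sum_le_sum fun a _ => ?_
        rw [← Finset.sum_filter, ← Finset.mul_sum, ← Finset.sum_div]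
        exact mul_le_of_le_one_right (h0 a) (div_self_le_one _)
    _ = 1 := h1

theorem H_pair_add_le (h0 : ∀ ω, 0 ≤ p ω) (h1 : ∑ ω, p ω = 1)
    {X : Ω → α} {Y : Ω → β} {Z : Ω → γ}
    (hX : ∀ ω ω', X ω = X ω' → Z ω = Z ω') (hY : ∀ ω ω', Y ω = Y ω' → Z ω = Z ω') :
    H p (fun ω => (X ω, Y ω)) + H p Z ≤ H p X + H p Y := by
  have key : ∑ ω, p ω * (Real.log (pm p X (X ω)) + Real.log (pm p Y (Y ω))
      - Real.log (pm p (fun ω => (X ω, Y ω)) (X ω, Y ω)) - Real.log (pm p Z (Z ω))) ≤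
      ∑ ω, (p ω * (pm p X (X ω) * pm p Y (Y ω) /
        (pm p (fun ω => (X ω, Y ω)) (X ω, Y ω) * pm p Z (Z ω))) - p ω) := by
    refine Finset.sum_le_sum fun ω _ => ?_
    rcases (h0 ω).eq_or_lt with hω | hω
    · simp [← hω]
    have hx := hω.trans_le (le_pm h0 X ω)
    have hy := hω.trans_le (le_pm h0 Y ω)
    have hz := hω.trans_le (le_pm h0 Z ω)
    have hxy := hω.trans_le (le_pm h0 (fun ω => (X ω, Y ω)) ω)
    have hlog := Real.log_le_sub_one_of_pos (div_pos (mul_pos hx hy) (mul_pos hxy hz))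
    rw [Real.log_div (mul_pos hx hy).ne' (mul_pos hxy hz).ne', Real.log_mul hx.ne' hy.ne',
      Real.log_mul hxy.ne' hz.ne'] at hlog
    have := mul_le_mul_of_nonneg_left hlog (h0 ω)
    linarith
  rw [Finset.sum_sub_distrib, h1] at key
  have ratio := sum_pm_ratio_le_one h0 h1 hX hY
  simp only [mul_add, mul_sub, Finset.sum_add_distrib, Finset.sum_sub_distrib] at key
  unfold H
  linarith

end Entropy

section Lists

/-- The tuple `A` is determined by the tuple `B`. -/
def Code.Det (C : Code Ω V d) (A B : List Atom) : Prop :=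
  ∀ ω ω', (∀ b ∈ B, C.atomRV b ω = C.atomRV b ω') → ∀ a ∈ A, C.atomRV a ω = C.atomRV a ω'

variable (C : Code Ω V d)

theorem Code.rv_eq_iff (L : List Atom) (ω ω' : Ω) :
    C.rv L ω = C.rv L ω' ↔ ∀ a ∈ L, C.atomRV a ω = C.atomRV a ω' := by
  simp [Code.rv]

variable {C}

theorem Code.Det.of_subset {A B : List Atom} (h : ∀ a ∈ A, a ∈ B) : C.Det A B :=
  fun _ _ hB a ha => hB a (h a ha)

theorem Code.Det.trans {A B D : List Atom} (h : C.Det A B) (h' : C.Det B D) : C.Det A D :=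
  fun ω ω' hD => h ω ω' (h' ω ω' hD)

theorem Code.Det.append {A B D : List Atom} (h : C.Det A D) (h' : C.Det B D) :
    C.Det (A ++ B) D := fun ω ω' hD a ha =>
  (List.mem_append.1 ha).elim (h ω ω' hD a) (h' ω ω' hD a)

theorem Code.Det.append_mono {A A' B B' : List Atom} (h : C.Det A A') (h' : C.Det B B') :
    C.Det (A ++ B) (A' ++ B') :=
  (h.trans (.of_subset (by simp +contextual))).append
    (h'.trans (.of_subset (by simp +contextual)))

theorem Code.HL_mono {A B : List Atom} (h : C.Det A B) : C.HL A ≤ C.HL B :=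
  H_le_of_determined C.p_nonneg fun ω ω' hB =>
    (C.rv_eq_iff A ω ω').2 (h ω ω' ((C.rv_eq_iff B ω ω').1 hB))

theorem Code.HL_congr {A B : List Atom} (h : ∀ a, a ∈ A ↔ a ∈ B) : C.HL A = C.HL B :=
  le_antisymm (HL_mono (.of_subset fun a => (h a).1)) (HL_mono (.of_subset fun a => (h a).2))

theorem Code.HL_submodular {A B D E : List Atom} (hA : C.Det D A) (hB : C.Det D B)
    (hE : C.Det E (A ++ B)) : C.HL E + C.HL D ≤ C.HL A + C.HL B := by
  have h := H_pair_add_le (p := C.p) C.p_nonneg C.p_sum (X := C.rv A) (Y := C.rv B) (Z := C.rv D)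
    (fun ω ω' h => (C.rv_eq_iff D ω ω').2 (hA ω ω' ((C.rv_eq_iff A ω ω').1 h)))
    (fun ω ω' h => (C.rv_eq_iff D ω ω').2 (hB ω ω' ((C.rv_eq_iff B ω ω').1 h)))
  refine le_trans (add_le_add ?_ le_rfl) h
  refine H_le_of_determined C.p_nonneg fun ω ω' hAB => (C.rv_eq_iff E ω ω').2 ?_
  have h₁ := (C.rv_eq_iff A ω ω').1 (congrArg Prod.fst hAB)
  have h₂ := (C.rv_eq_iff B ω ω').1 (congrArg Prod.snd hAB)
  exact hE ω ω' fun b hb => (List.mem_append.1 hb).elim (h₁ b) (h₂ b)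

theorem Code.HL_nil : C.HL [] = 0 := by
  have h : pm C.p (fun _ : Ω => ([] : List V)) [] = 1 := by simp [pm, C.p_sum]
  change -∑ ω, C.p ω * Real.log (pm C.p (fun _ : Ω => ([] : List V)) []) = 0
  simp [h]

/-- Subadditivity of conditional entropy over the entries of a tuple. -/
theorem Code.HL_append_le (L X : List Atom) :
    C.HL (L ++ X) - C.HL X ≤ (L.map fun a => C.HL (a :: X) - C.HL X).sum := by
  induction L with
  | nil => simp
  | cons a L ih =>
    have h := C.HL_submodular (A := a :: X) (B := L ++ X) (D := X) (E := a :: L ++ X)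
      (.of_subset (by simp +contextual)) (.of_subset (by simp +contextual))
      (.of_subset (by simp; tauto))
    simp only [List.map_cons, List.sum_cons]
    linarith

end Lists

section Nodes

theorem mem_icc {a b k : ℕ} : k ∈ icc a b ↔ a ≤ k ∧ k ≤ b := by
  rw [icc, List.mem_range'_1]
  omega

theorem mem_SbarTo {j : ℕ} {a : Atom} :
    a ∈ SbarTo d j ↔ ∃ k, j < k ∧ k ≤ d + 1 ∧ a = .S k j := by
  simp only [SbarTo, Sto, List.mem_map, mem_icc]
  constructor
  · rintro ⟨k, hk, rfl⟩
    exact ⟨k, hk.1, hk.2, rfl⟩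
  · rintro ⟨k, h₁, h₂, rfl⟩
    exact ⟨k, ⟨h₁, h₂⟩, rfl⟩

theorem mem_U {t s : ℕ} {a : Atom} : a ∈ U d t s ↔
    (∃ j, 1 ≤ j ∧ j ≤ t ∧ a = .W j) ∨
      ∃ j k, t < j ∧ j ≤ s ∧ j < k ∧ k ≤ d + 1 ∧ a = .S k j := by
  simp only [U, SbarToL, Ws, List.mem_append, List.mem_map, List.mem_flatten, mem_icc]
  constructor
  · rintro (⟨j, hj, rfl⟩ | ⟨_, ⟨j, hj, rfl⟩, ha⟩)
    · exact .inl ⟨j, hj.1, hj.2, rfl⟩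
    · obtain ⟨k, h₁, h₂, rfl⟩ := mem_SbarTo.1 ha
      exact .inr ⟨j, k, hj.1, hj.2, h₁, h₂, rfl⟩
  · rintro (⟨j, h₁, h₂, rfl⟩ | ⟨j, k, h₁, h₂, h₃, h₄, rfl⟩)
    · exact .inl ⟨j, ⟨h₁, h₂⟩, rfl⟩
    · exact .inr ⟨_, ⟨j, ⟨h₁, h₂⟩, rfl⟩, mem_SbarTo.2 ⟨k, h₃, h₄, rfl⟩⟩

theorem mem_U_succ {t s : ℕ} (hts : t ≤ s) {a : Atom} :
    a ∈ U d t (s + 1) ↔ a ∈ SbarTo d (s + 1) ∨ a ∈ U d t s := by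
  rw [mem_U, mem_U, mem_SbarTo]
  constructor
  · rintro (h | ⟨j, k, h₁, h₂, h₃, h₄, rfl⟩)
    · exact .inr (.inl h)
    · rcases Nat.lt_or_ge s j with h | h
      · obtain rfl : j = s + 1 := by omega
        exact .inl ⟨k, h₃, h₄, rfl⟩
      · exact .inr (.inr ⟨j, k, h₁, h, h₃, h₄, rfl⟩)
  · rintro (⟨k, h₁, h₂, rfl⟩ | h | ⟨j, k, h₁, h₂, h₃, h₄, rfl⟩)
    · exact .inr ⟨s + 1, k, by omega, le_rfl, h₁, h₂, rfl⟩
    · exact .inl h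
    · exact .inr ⟨j, k, h₁, by omega, h₃, h₄, rfl⟩

variable {C : Code Ω V d}

theorem Code.det_S_W (C : Code Ω V d) {i j : ℕ} (hi : i ∈ Finset.Icc 1 (d + 1))
    (hj : j ∈ Finset.Icc 1 (d + 1)) (hij : i ≠ j) : C.Det [.S i j] [.W i] := by
  obtain ⟨f, hf⟩ := C.S_func i hi j hj hij
  intro ω ω' h a ha
  obtain rfl := List.mem_singleton.1 ha
  have := h (.W i) (by simp)
  simp only [atomRV] at this ⊢
  rw [hf, hf, this]

theorem Code.NodeRegen.det_W (hregen : C.NodeRegen) {t s : ℕ} (hs : s ≤ d + 1) :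
    C.Det (Ws (icc 1 s)) (U d t s) := by
  intro ω ω' h a ha
  obtain ⟨j, hj, rfl⟩ := List.mem_map.1 ha
  rw [mem_icc] at hj
  clear ha
  induction j using Nat.strong_induction_on with
  | _ j ih =>
    rcases Nat.lt_or_ge t j with htj | htj
    · obtain ⟨f, hf⟩ := hregen j (Finset.mem_Icc.2 ⟨hj.1, hj.2.trans hs⟩)
      have hS : C.rv (StoFull d j) ω = C.rv (StoFull d j) ω' := by
        rw [C.rv_eq_iff]
        intro b hb
        simp only [StoFull, Sto, List.mem_map, List.mem_filter, mem_icc] at hb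
        obtain ⟨k, ⟨hk, hkj⟩, rfl⟩ := hb
        have hkj : k ≠ j := by simpa using hkj
        rcases Nat.lt_or_ge k j with hlt | hge
        · refine C.det_S_W (Finset.mem_Icc.2 hk) (Finset.mem_Icc.2 ⟨hj.1, hj.2.trans hs⟩) hkj
            ω ω' ?_ _ (List.mem_singleton_self _)
          simpa using ih k hlt ⟨hk.1, by omega⟩
        · exact h _ (mem_U.2 (.inr ⟨j, k, htj, hj.2, by omega, hk.2, rfl⟩))
      change C.W j ω = C.W j ω'
      rw [hf, hf, hS]
    · exact h _ (mem_U.2 (.inl ⟨j, hj.1, htj, rfl⟩))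

theorem Code.MsgRecovery.det_M {ℓ : ℕ} (hrec : C.MsgRecovery ℓ) {k : ℕ} (hk : k ≤ d) :
    C.Det (MsL (icc (ℓ + 1) k)) (Ws (icc 1 k)) := by
  intro ω ω' h a ha
  obtain ⟨j, hj, rfl⟩ := List.mem_map.1 ha
  rw [mem_icc] at hj
  have hf := hrec.2 (Finset.Icc 1 j) (Finset.Icc_subset_Icc le_rfl (by omega))
    (by simp; omega)
  simp only [Nat.card_Icc, Nat.add_sub_cancel] at hf
  obtain ⟨f, hf⟩ := hf
  have hW : C.rv (Ws ((Finset.Icc 1 j).sort (· ≤ ·))) ω =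
      C.rv (Ws ((Finset.Icc 1 j).sort (· ≤ ·))) ω' := by
    rw [C.rv_eq_iff]
    intro b hb
    obtain ⟨i, hi, rfl⟩ := List.mem_map.1 hb
    rw [Finset.mem_sort, Finset.mem_Icc] at hi
    exact h _ (List.mem_map_of_mem (mem_icc.2 ⟨hi.1, hi.2.trans hj.2⟩))
  change C.M j ω = C.M j ω'
  rw [hf, hf, hW]

end Nodes

section Symmetry

variable {C : Code Ω V d}

theorem swap_fixes_lt {i x y : ℕ} (hx : i < x) (hy : i < y) :
    ∀ j ≤ i, Equiv.swap x y j = j := fun j hj =>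
  Equiv.swap_apply_of_ne_of_ne (by omega) (by omega)

theorem swap_mem_Icc_iff {n x y : ℕ} (hx : x ∈ Finset.Icc 1 n) (hy : y ∈ Finset.Icc 1 n) (k : ℕ) :
    Equiv.swap x y k ∈ Finset.Icc 1 n ↔ k ∈ Finset.Icc 1 n := by
  rw [Equiv.swap_apply_def]
  split_ifs with h₁ h₂
  · subst h₁; simp only [hx, hy]
  · subst h₂; simp only [hx, hy]
  · rfl

theorem mem_map_perm_U {t i : ℕ} (hti : t ≤ i) {π : Equiv.Perm ℕ} (hfix : ∀ j ≤ i, π j = j)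
    (hmem : ∀ k, π k ∈ Finset.Icc 1 (d + 1) ↔ k ∈ Finset.Icc 1 (d + 1)) (a : Atom) :
    a ∈ (U d t i).map (Atom.perm π) ↔ a ∈ U d t i := by
  have hfix' : ∀ j ≤ i, π.symm j = j := fun j hj => by
    rw [Equiv.symm_apply_eq, hfix j hj]
  have hlt : ∀ {σ : Equiv.Perm ℕ}, (∀ j ≤ i, σ.symm j = j) → ∀ k, i < k → i < σ k := by
    intro σ hσ k hk
    by_contra! hle
    have := hσ _ hle
    rw [Equiv.symm_apply_apply] at this
    omega
  have hmove : ∀ {σ : Equiv.Perm ℕ}, (∀ j ≤ i, σ j = j) → (∀ j ≤ i, σ.symm j = j) →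
      (∀ k ∈ Finset.Icc 1 (d + 1), σ k ∈ Finset.Icc 1 (d + 1)) →
      ∀ b ∈ U d t i, b.perm σ ∈ U d t i := by
    intro σ hσ hσ' hm b hb
    rcases mem_U.1 hb with ⟨j, h₁, h₂, rfl⟩ | ⟨j, k, h₁, h₂, h₃, h₄, rfl⟩
    · rw [Atom.perm, hσ j (h₂.trans hti)]
      exact hb
    · rw [Atom.perm, hσ j h₂]
      rcases Nat.lt_or_ge i k with hk | hk
      · exact mem_U.2 (.inr ⟨j, σ k, h₁, h₂, by have := hlt hσ' k hk; omega,
          (Finset.mem_Icc.1 (hm k (Finset.mem_Icc.2 ⟨by omega, h₄⟩))).2, rfl⟩)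
      · rw [hσ k hk]
        exact hb
  rw [List.mem_map]
  constructor
  · rintro ⟨b, hb, rfl⟩
    exact hmove hfix hfix' (fun k hk => (hmem k).2 hk) b hb
  · refine fun ha => ⟨a.perm π.symm, hmove hfix' (by simpa using hfix) (fun k hk => ?_) a ha, ?_⟩
    · rwa [← hmem, Equiv.apply_symm_apply]
    · cases a <;> simp [Atom.perm]

theorem map_perm_MsL (π : Equiv.Perm ℕ) (A : List ℕ) :
    (MsL A).map (Atom.perm π) = MsL A := by
  simp [MsL, Atom.perm]

/-- Relabelling nodes that the conditioning tuple treats alike does not change entropy. -/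
theorem Code.Symmetrical.HL_map_append (hsym : C.Symmetrical) {t i : ℕ} (hti : t ≤ i)
    {π : Equiv.Perm ℕ} (hfix : ∀ j ≤ i, π j = j)
    (hmem : ∀ k, π k ∈ Finset.Icc 1 (d + 1) ↔ k ∈ Finset.Icc 1 (d + 1)) (L : List Atom)
    (A : List ℕ) :
    C.HL (L.map (Atom.perm π) ++ (U d t i ++ MsL A)) = C.HL (L ++ (U d t i ++ MsL A)) := by
  rw [← hsym π (fun k hk => (hmem k).2 hk) (L ++ (U d t i ++ MsL A))]
  refine HL_congr fun a => ?_
  simp only [List.map_append, List.mem_append, mem_map_perm_U hti hfix hmem, map_perm_MsL]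

theorem SbarTo_length (j : ℕ) : (SbarTo d j).length = d + 1 - j := by
  simp [SbarTo, Sto, icc]

/-- Exchange inequality: once one repair symbol towards node `i + 2` is known, the remaining ones
are, on average, less informative than the repair symbols towards node `i + 1`. -/
theorem Code.Symmetrical.exchange (hsym : C.Symmetrical) {t i : ℕ} (hti : t ≤ i) (hid : i < d)
    (A : List ℕ) {Y : List Atom} (hX : C.Det (U d t i ++ MsL A) Y)
    (hS : C.Det [.S (i + 1) (i + 2)] Y) :
    ((d : ℝ) - i) * (C.HL (SbarTo d (i + 2) ++ Y) - C.HL Y) ≤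
      ((d : ℝ) - i - 1) *
        (C.HL (U d t (i + 1) ++ MsL A) - C.HL (U d t i ++ MsL A)) := by
  set X := U d t i ++ MsL A with hXdef
  have hfull : C.HL (U d t (i + 1) ++ MsL A) = C.HL (SbarTo d (i + 1) ++ X) :=
    HL_congr fun a => by simp [hXdef, mem_U_succ hti, or_assoc]
  have hswap : C.HL (Atom.S (i + 1) (i + 2) :: SbarTo d (i + 2) ++ X) =
      C.HL (SbarTo d (i + 1) ++ X) := by
    refine Eq.trans ?_ (hsym.HL_map_append hti
      (swap_fixes_lt (x := i + 1) (y := i + 2) (by omega) (by omega))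
      (swap_mem_Icc_iff (by simp; omega) (by simp; omega)) _ _)
    refine HL_congr fun a => ?_
    rw [← hXdef]
    simp only [List.mem_append (t := X), List.mem_cons, List.mem_map, mem_SbarTo]
    refine or_congr_left ⟨?_, ?_⟩
    · rintro (rfl | ⟨k, h₁, h₂, rfl⟩)
      · exact ⟨_, ⟨i + 2, by omega, by omega, rfl⟩, by simp [Atom.perm]⟩
      · refine ⟨_, ⟨k, by omega, by omega, rfl⟩, ?_⟩
        rw [Atom.perm, Equiv.swap_apply_of_ne_of_ne (by omega) (by omega), Equiv.swap_apply_left]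
    · rintro ⟨_, ⟨k, h₁, h₂, rfl⟩, rfl⟩
      rcases eq_or_ne k (i + 2) with rfl | hk
      · exact .inl (by simp [Atom.perm])
      · refine .inr ⟨k, by omega, h₂, ?_⟩
        rw [Atom.perm, Equiv.swap_apply_of_ne_of_ne (by omega) (by omega), Equiv.swap_apply_left]
  have hone : ∀ a ∈ SbarTo d (i + 1), C.HL (a :: X) = C.HL (.S (i + 1) (i + 2) :: X) := by
    intro a ha
    obtain ⟨k, h₁, h₂, rfl⟩ := mem_SbarTo.1 ha
    have e₁ := hsym.HL_map_append hti
      (swap_fixes_lt (x := k) (y := i + 2) (by omega) (by omega))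
      (swap_mem_Icc_iff (by simp; omega) (by simp; omega)) [.S k (i + 1)] A
    have e₂ := hsym.HL_map_append hti
      (swap_fixes_lt (x := i + 1) (y := i + 2) (by omega) (by omega))
      (swap_mem_Icc_iff (by simp; omega) (by simp; omega)) [.S (i + 2) (i + 1)] A
    simp only [List.map_cons, List.map_nil, Atom.perm, Equiv.swap_apply_left,
      Equiv.swap_apply_right] at e₁ e₂
    rw [Equiv.swap_apply_of_ne_of_ne (by omega) (by omega)] at e₁
    exact e₁.symm.trans e₂.symm
  have hhan : C.HL (SbarTo d (i + 1) ++ X) - C.HL X ≤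
      ((d : ℝ) - i) * (C.HL (.S (i + 1) (i + 2) :: X) - C.HL X) := by
    refine (C.HL_append_le _ _).trans (le_of_eq ?_)
    rw [List.map_congr_left fun a ha => by rw [hone a ha], List.map_const', List.sum_replicate,
      SbarTo_length, nsmul_eq_mul, Nat.cast_sub (by omega)]
    push_cast
    ring
  have hsub := C.HL_submodular (A := Atom.S (i + 1) (i + 2) :: SbarTo d (i + 2) ++ X) (B := Y)
    (D := .S (i + 1) (i + 2) :: X) (E := SbarTo d (i + 2) ++ Y)
    (.of_subset (by simp; tauto)) (hS.append hX) (.of_subset (by simp; tauto))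
  have hdi : (0 : ℝ) < (d : ℝ) - i := sub_pos.2 (by exact_mod_cast hid)
  have := mul_le_mul_of_nonneg_left hsub hdi.le
  rw [hfull]
  rw [hswap] at this
  linarith

end Symmetry

section Messages

variable {C : Code Ω V d}

theorem sum_map_icc (f : ℕ → ℝ) (a b : ℕ) :
    ((icc a b).map f).sum = ∑ j ∈ Finset.Icc a b, f j := by
  have h : Finset.Icc a b = (icc a b).toFinset := by
    ext k
    rw [List.mem_toFinset, mem_icc, Finset.mem_Icc]
  rw [h, List.sum_toFinset f (show (icc a b).Nodup from List.nodup_range')]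

theorem Code.HL_append_le_add (C : Code Ω V d) (A B : List Atom) :
    C.HL (A ++ B) ≤ C.HL A + C.HL B := by
  have h := C.HL_submodular (A := A) (B := B) (D := []) (E := A ++ B)
    (.of_subset (by simp)) (.of_subset (by simp)) (.of_subset (by simp))
  rw [HL_nil] at h
  linarith

theorem Code.HL_MsL_append_le (C : Code Ω V d) (a b : ℕ) (X : List Atom) :
    C.HL (MsL (icc a b) ++ X) ≤ ∑ j ∈ Finset.Icc a b, C.HL [.M j] + C.HL X := by
  have h := C.HL_append_le (MsL (icc a b)) X
  rw [MsL, List.map_map] at h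
  have h' : ((icc a b).map ((fun a => C.HL (a :: X) - C.HL X) ∘ Atom.M)).sum ≤
      ((icc a b).map fun j => C.HL [.M j]).sum := by
    refine List.sum_le_sum fun j _ => ?_
    have := C.HL_append_le_add [.M j] X
    simp only [List.singleton_append] at this
    simp only [Function.comp]
    linarith
  rw [sum_map_icc (fun j => C.HL [.M j])] at h'
  rw [MsL]
  linarith

theorem Code.HL_singleton_M (C : Code Ω V d) (j : ℕ) : C.HL [.M j] = H C.p (C.M j) :=
  le_antisymm
    (H_le_of_determined C.p_nonneg fun ω ω' h => by simpa [Code.rv, atomRV] using h)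
    (H_le_of_determined C.p_nonneg fun ω ω' h => by simpa [Code.rv, atomRV] using h)

theorem Code.sum_le_HL_MsL_one (C : Code Ω V d) :
    ∑ j ∈ Finset.Icc 1 d, C.HL [.M j] ≤ C.HL (MsL (icc 1 d)) := by
  have hle : H C.p (fun ω (i : Fin d) => C.M (↑i + 1) ω) ≤ C.HL (MsL (icc 1 d)) := by
    refine H_le_of_determined C.p_nonneg fun ω ω' h => funext fun i => ?_
    exact (C.rv_eq_iff _ _ _).1 h (.M (i + 1))
      (List.mem_map_of_mem (mem_icc.2 ⟨by omega, by omega⟩))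
  refine le_trans (le_of_eq ?_) hle
  simp only [HL_singleton_M, H, Finset.sum_neg_distrib]
  rw [Finset.sum_comm]
  congr 1
  refine Finset.sum_congr rfl fun ω _ => ?_
  rw [← Finset.mul_sum]
  rcases (C.p_nonneg ω).eq_or_lt with hω | hω
  · simp [← hω]
  · rw [C.M_indep fun j => C.M j ω, Real.log_prod]
    exact fun j _ => (hω.trans_le (le_pm C.p_nonneg (C.M j) ω)).ne'

theorem sum_Icc_split (f : ℕ → ℝ) {a b c : ℕ} (hab : a ≤ b + 1) (hbc : b ≤ c) :
    ∑ j ∈ Finset.Icc a c, f j = ∑ j ∈ Finset.Icc a b, f j + ∑ j ∈ Finset.Icc (b + 1) c, f j := by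
  rw [← Finset.sum_union]
  · congr 1
    ext j
    simp only [Finset.mem_union, Finset.mem_Icc]
    omega
  · rw [Finset.disjoint_left]
    intro j
    simp only [Finset.mem_Icc]
    omega

theorem Code.sum_le_HL_MsL (C : Code Ω V d) {ℓ : ℕ} (hℓ : ℓ ≤ d) :
    ∑ j ∈ Finset.Icc (ℓ + 1) d, C.HL [.M j] ≤ C.HL (MsL (icc (ℓ + 1) d)) := by
  have h₁ := C.HL_MsL_append_le 1 ℓ (MsL (icc (ℓ + 1) d))
  have h₂ : C.HL (MsL (icc 1 ℓ) ++ MsL (icc (ℓ + 1) d)) = C.HL (MsL (icc 1 d)) := by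
    refine HL_congr fun a => ?_
    simp only [MsL, ← List.map_append, List.mem_map, List.mem_append, mem_icc]
    refine exists_congr fun j => and_congr_left fun _ => ?_
    omega
  have h₃ := C.sum_le_HL_MsL_one
  rw [sum_Icc_split _ (by omega) hℓ] at h₃
  linarith

theorem mem_MsL_icc_succ {a k : ℕ} (h : a ≤ k + 1) {x : Atom} :
    x ∈ MsL (icc a (k + 1)) ↔ x ∈ MsL (icc a k) ∨ x = .M (k + 1) := by
  simp only [MsL, List.mem_map, mem_icc]
  constructor
  · rintro ⟨j, hj, rfl⟩
    rcases Nat.lt_or_ge k j with hk | hk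
    · exact .inr (congrArg _ (by omega))
    · exact .inl ⟨j, ⟨hj.1, hk⟩, rfl⟩
  · rintro (⟨j, hj, rfl⟩ | rfl)
    · exact ⟨j, ⟨hj.1, by omega⟩, rfl⟩
    · exact ⟨k + 1, ⟨h, le_rfl⟩, rfl⟩

/-- Given the eavesdropped data and the preceding messages, a message keeps its full entropy. -/
theorem Code.RepairSecrecy.le_sub {ℓ₁ ℓ₂ k : ℕ} (hsec : C.RepairSecrecy ℓ₁ ℓ₂)
    (hk : ℓ₁ + ℓ₂ ≤ k) (hkd : k < d) :
    C.HL [.M (k + 1)] ≤ C.HL (U d ℓ₁ (ℓ₁ + ℓ₂) ++ MsL (icc (ℓ₁ + ℓ₂ + 1) (k + 1))) -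
      C.HL (U d ℓ₁ (ℓ₁ + ℓ₂) ++ MsL (icc (ℓ₁ + ℓ₂ + 1) k)) := by
  set ℓ := ℓ₁ + ℓ₂ with hℓ
  have hMI := hsec (Finset.Icc 1 ℓ₁) (Finset.Icc (ℓ₁ + 1) ℓ)
    (Finset.Icc_subset_Icc le_rfl (by omega)) (Finset.Icc_subset_Icc (by omega) (by omega))
    (by rw [Finset.disjoint_left]; intro j; simp only [Finset.mem_Icc]; omega)
    (by simp) (by simp; omega)
  set Z := Ws ((Finset.Icc 1 ℓ₁).sort (· ≤ ·)) ++
    StoFullL d ((Finset.Icc (ℓ₁ + 1) ℓ).sort (· ≤ ·)) with hZ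
  rw [MI, ← hℓ] at hMI
  have hUZ : ∀ a ∈ U d ℓ₁ ℓ, a ∈ Z := by
    intro a ha
    rw [hZ, List.mem_append]
    rcases mem_U.1 ha with ⟨j, h₁, h₂, rfl⟩ | ⟨j, i, h₁, h₂, h₃, h₄, rfl⟩
    · exact .inl (List.mem_map_of_mem
        ((Finset.mem_sort _).2 (Finset.mem_Icc.2 ⟨h₁, h₂⟩)))
    · refine .inr (List.mem_flatten.2 ⟨_, List.mem_map_of_mem
        ((Finset.mem_sort _).2 (Finset.mem_Icc.2 ⟨h₁, h₂⟩)), ?_⟩)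
      refine List.mem_map.2 ⟨i, List.mem_filter.2 ⟨mem_icc.2 ⟨by omega, h₄⟩, ?_⟩, rfl⟩
      simpa using (by omega : i ≠ j)
  have h₁ := C.HL_MsL_append_le (k + 1 + 1) d (MsL (icc (ℓ + 1) (k + 1)) ++ Z)
  have h₂ := C.HL_MsL_append_le (ℓ + 1) k Z
  have h₃ := C.sum_le_HL_MsL (ℓ := ℓ) (by omega)
  rw [sum_Icc_split _ (b := k) (by omega) (by omega),
    sum_Icc_split _ (a := k + 1) (b := k + 1) (by omega) (by omega), Finset.Icc_self,
    Finset.sum_singleton] at h₃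
  have h₄ : C.HL (MsL (icc (ℓ + 1) d) ++ Z) =
      C.HL (MsL (icc (k + 1 + 1) d) ++ (MsL (icc (ℓ + 1) (k + 1)) ++ Z)) := by
    refine HL_congr fun a => ?_
    simp only [← List.append_assoc, List.mem_append]
    refine or_congr_left ?_
    simp only [MsL, List.mem_map, mem_icc, ← exists_or, ← or_and_right]
    refine exists_congr fun j => and_congr_left fun _ => ?_
    omega
  have h₅ := C.HL_submodular (A := U d ℓ₁ ℓ ++ MsL (icc (ℓ + 1) (k + 1)))
    (B := MsL (icc (ℓ + 1) k) ++ Z) (D := U d ℓ₁ ℓ ++ MsL (icc (ℓ + 1) k))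
    (E := MsL (icc (ℓ + 1) (k + 1)) ++ Z)
    (.of_subset fun a => by
      simp only [List.mem_append, mem_MsL_icc_succ (show ℓ + 1 ≤ k + 1 by omega)]; tauto)
    (.of_subset fun a => by
      simp only [List.mem_append]; exact fun h => h.elim (fun h => .inr (hUZ a h)) .inl)
    (.of_subset fun a => by simp only [List.mem_append]; tauto)
  linarith

end Messages

section Rotation

variable {C : Code Ω V d}

/-- The permutation sending `a` to `b` and shifting `a + 1, …, b` down by one. -/
def rotDown (a b : ℕ) (h : a ≤ b) : Equiv.Perm ℕ where
  toFun j := if j = a then b else if a < j ∧ j ≤ b then j - 1 else j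
  invFun j := if j = b then a else if a ≤ j ∧ j < b then j + 1 else j
  left_inv j := by dsimp only; split_ifs <;> omega
  right_inv j := by dsimp only; split_ifs <;> omega

theorem rotDown_apply {a b : ℕ} (h : a ≤ b) (j : ℕ) :
    rotDown a b h j = if j = a then b else if a < j ∧ j ≤ b then j - 1 else j := rfl

/-- Up to relabelling, `U^{(t+1,i+1)}` is `U^{(t,i)}` together with one more node. -/
theorem Code.Symmetrical.HL_U_succ (hsym : C.Symmetrical) {t i : ℕ} (hti : t ≤ i) (hid : i < d)
    {L : List Atom} (hL : L.map (Atom.perm (rotDown (t + 1) (i + 1) (by omega))) = L) :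
    C.HL (L ++ U d (t + 1) (i + 1)) = C.HL (L ++ (.W (i + 1) :: U d t i)) := by
  set π := rotDown (t + 1) (i + 1) (by omega) with hπ
  rw [← hsym π (fun k hk => ?_) (L ++ U d (t + 1) (i + 1)), List.map_append, hL]
  swap
  · rw [Finset.mem_Icc] at hk ⊢
    rw [hπ, rotDown_apply]
    split_ifs <;> omega
  have hW : Atom.W (i + 1) ∈ (U d (t + 1) (i + 1)).map (Atom.perm π) :=
    List.mem_map.2 ⟨.W (t + 1), mem_U.2 (.inl ⟨t + 1, by omega, le_rfl, rfl⟩),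
      by simp [Atom.perm, hπ, rotDown_apply]⟩
  refine le_antisymm (HL_mono (.append_mono (.of_subset fun _ h => h) (.of_subset ?_)))
    (HL_mono (.append_mono (.of_subset fun _ h => h) ?_))
  · intro a ha
    obtain ⟨b, hb, rfl⟩ := List.mem_map.1 ha
    rw [List.mem_cons, mem_U]
    rcases mem_U.1 hb with ⟨j, h₁, h₂, rfl⟩ | ⟨j, k, h₁, h₂, h₃, h₄, rfl⟩
    · rcases eq_or_ne j (t + 1) with rfl | hj
      · exact .inl (by simp [Atom.perm, hπ, rotDown_apply])
      · refine .inr (.inl ⟨j, h₁, by omega, ?_⟩)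
        rw [Atom.perm, hπ, rotDown_apply, if_neg hj, if_neg (by omega)]
    · refine .inr (.inr ⟨π j, π k, ?_, ?_, ?_, ?_, rfl⟩) <;>
        simp only [hπ, rotDown_apply] <;> split_ifs <;> omega
  · intro ω ω' h a ha
    rcases List.mem_cons.1 ha with rfl | ha
    · exact h _ hW
    rcases mem_U.1 ha with ⟨j, h₁, h₂, rfl⟩ | ⟨j, k, h₁, h₂, h₃, h₄, rfl⟩
    · refine h _ (List.mem_map.2 ⟨.W j, mem_U.2 (.inl ⟨j, h₁, by omega, rfl⟩), ?_⟩)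
      rw [Atom.perm, hπ, rotDown_apply, if_neg (by omega), if_neg (by omega)]
    · have hj : π (j + 1) = j := by
        rw [hπ, rotDown_apply, if_neg (by omega), if_pos (by omega), Nat.add_sub_cancel]
      rcases lt_trichotomy k (i + 1) with hk | rfl | hk
      · refine h _ (List.mem_map.2 ⟨.S (k + 1) (j + 1), mem_U.2 (.inr ⟨j + 1, k + 1, by omega,
          by omega, by omega, by omega, rfl⟩), ?_⟩)
        rw [Atom.perm, hj, hπ, rotDown_apply, if_neg (by omega), if_pos (by omega),
          Nat.add_sub_cancel]
      · exact C.det_S_W (by simp; omega) (by simp; omega) (by omega) ω ω'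
          (by simpa using h _ hW) _ (List.mem_singleton_self _)
      · refine h _ (List.mem_map.2 ⟨.S k (j + 1), mem_U.2 (.inr ⟨j + 1, k, by omega,
          by omega, by omega, by omega, rfl⟩), ?_⟩)
        rw [Atom.perm, hj, hπ, rotDown_apply, if_neg (by omega), if_neg (by omega)]

end Rotation

section Averages

theorem T_self (ℓ : ℕ) : T d ℓ ℓ = 0 := by simp [T]

theorem T_succ {ℓ k : ℕ} (h : ℓ ≤ k) : T d (k + 1) ℓ = T d k ℓ + ((d : ℝ) - k) := by
  rw [T, Finset.sum_Icc_succ_top (by omega), T]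
  push_cast
  ring

theorem T_succ_pos {ℓ k : ℕ} (h : ℓ ≤ k) (hk : k < d) : 0 < T d (k + 1) ℓ := by
  refine Finset.sum_pos (fun t ht => ?_) ⟨ℓ + 1, by simp; omega⟩
  have : (t : ℝ) < (d : ℝ) + 1 := by
    exact_mod_cast (by have := (Finset.mem_Icc.1 ht).2; omega : t < d + 1)
  linarith

theorem T_mul_increment_le {g : ℕ → ℝ} {ℓ : ℕ}
    (hg : ∀ i, ℓ ≤ i → i + 1 < d →
      ((d : ℝ) - i) * (g (i + 2) - g (i + 1)) ≤ ((d : ℝ) - i - 1) * (g (i + 1) - g i))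
    {k : ℕ} (hk : ℓ ≤ k) (hkd : k < d) :
    T d k ℓ * (g (k + 1) - g k) ≤ ((d : ℝ) - k) * (g k - g ℓ) := by
  induction k, hk using Nat.le_induction with
  | base => simp [T_self]
  | succ k hk ih =>
    have hE := hg k hk hkd
    have ih := ih (by omega)
    have hT := (T_succ_pos hk (by omega : k < d)).le
    have hc : (0 : ℝ) < (d : ℝ) - k := sub_pos.2 (by exact_mod_cast (by omega : k < d))
    have hc' : (0 : ℝ) ≤ (d : ℝ) - k - 1 := by
      have : ((k + 1 : ℕ) : ℝ) ≤ d := by exact_mod_cast hkd.le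
      push_cast at this
      linarith
    have ih' : T d (k + 1) ℓ * (g (k + 1) - g k) ≤ ((d : ℝ) - k) * (g (k + 1) - g ℓ) := by
      rw [T_succ hk]
      linarith
    have h₁ := mul_le_mul_of_nonneg_left hE hT
    have h₂ := mul_le_mul_of_nonneg_left ih' hc'
    refine le_of_mul_le_mul_left (?_ : ((d : ℝ) - k) * _ ≤ ((d : ℝ) - k) * _) hc
    push_cast
    linarith

/-- Peeling off one message at a time from the normalised increments of the
profiles `i ↦ h i q`. -/
theorem sum_add_average_le {h : ℕ → ℕ → ℝ} {B : ℕ → ℝ} {ℓ : ℕ}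
    (hE : ∀ q i, ℓ ≤ i → i + 1 < d → ((d : ℝ) - i) * (h (i + 2) q - h (i + 1) q) ≤
      ((d : ℝ) - i - 1) * (h (i + 1) q - h i q))
    (hB : ∀ k, ℓ ≤ k → k < d →
      B (k + 1) + (h (k + 1) (k + 1) - h ℓ (k + 1)) ≤ h (k + 1) k - h ℓ k)
    {k : ℕ} (hk : ℓ ≤ k) (hkd : k < d) :
    ∑ j ∈ Finset.Icc (ℓ + 1) (k + 1), (T d j ℓ)⁻¹ * B j +
      (h (k + 1) (k + 1) - h ℓ (k + 1)) / T d (k + 1) ℓ ≤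
      (h (ℓ + 1) ℓ - h ℓ ℓ) / ((d : ℝ) - ℓ) := by
  have peel : ∀ k, ℓ ≤ k → k < d → (T d (k + 1) ℓ)⁻¹ * B (k + 1) +
      (h (k + 1) (k + 1) - h ℓ (k + 1)) / T d (k + 1) ℓ ≤
      (h (k + 1) k - h ℓ k) / T d (k + 1) ℓ := fun k hk hkd => by
    rw [inv_mul_eq_div, ← add_div]
    exact div_le_div_of_nonneg_right (hB k hk hkd) (T_succ_pos hk hkd).le
  induction k, hk using Nat.le_induction with
  | base =>
    have := peel ℓ le_rfl hkd
    rw [Finset.Icc_self, Finset.sum_singleton]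
    refine this.trans (le_of_eq ?_)
    rw [T_succ le_rfl, T_self, zero_add]
  | succ k hk ih =>
    refine le_trans ?_ (ih (by omega))
    have hstep := peel (k + 1) (by omega) hkd
    have hT := T_succ_pos hk (by omega : k < d)
    have hT' := T_succ_pos (by omega : ℓ ≤ k + 1) hkd
    have hinc := T_mul_increment_le (g := fun i => h i (k + 1)) (hE (k + 1))
      (by omega : ℓ ≤ k + 1) hkd
    have havg : (h (k + 1 + 1) (k + 1) - h ℓ (k + 1)) / T d (k + 1 + 1) ℓ ≤
        (h (k + 1) (k + 1) - h ℓ (k + 1)) / T d (k + 1) ℓ := by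
      rw [div_le_div_iff₀ hT' hT, T_succ (by omega : ℓ ≤ k + 1)]
      linarith
    rw [Finset.sum_Icc_succ_top (by omega)]
    linarith

end Averages

section Increment

variable {C : Code Ω V d}

/-- The increment of `H(U^{(t+1,·)})` is controlled by that of `H(U^{(t,·)})` given messages. -/
theorem Code.Symmetrical.HL_U_succ_increment_le (hsym : C.Symmetrical) (hregen : C.NodeRegen)
    {ℓ : ℕ} (hrec : C.MsgRecovery ℓ) {t i : ℕ} (hti : t ≤ i) (hid : i < d) :
    ((d : ℝ) - i) * (C.HL (U d (t + 1) (i + 2)) - C.HL (U d (t + 1) (i + 1))) ≤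
      ((d : ℝ) - i - 1) * (C.HL (U d t (i + 1) ++ MsL (icc (ℓ + 1) (i + 1))) -
        C.HL (U d t i ++ MsL (icc (ℓ + 1) (i + 1)))) := by
  have hW : C.Det (Ws (icc 1 (i + 1))) (.W (i + 1) :: U d t i) := by
    intro ω ω' h a ha
    obtain ⟨j, hj, rfl⟩ := List.mem_map.1 ha
    rw [mem_icc] at hj
    rcases eq_or_ne j (i + 1) with rfl | hne
    · exact h _ (by simp)
    · exact hregen.det_W (t := t) (s := i) (by omega) ω ω' (fun b hb => h b (by simp [hb])) _
        (List.mem_map_of_mem (mem_icc.2 ⟨hj.1, by omega⟩))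
  have hS : C.Det [.S (i + 1) (i + 2)] (.W (i + 1) :: U d t i) :=
    (C.det_S_W (by simp; omega) (by simp; omega) (by omega)).trans (.of_subset (by simp))
  have hM := (hrec.det_M (by omega : i + 1 ≤ d)).trans hW
  have hX := hsym.exchange hti hid (icc (ℓ + 1) (i + 1))
    (Y := (.W (i + 1) :: U d t i) ++ MsL (icc (ℓ + 1) (i + 1)))
    (.of_subset (by simp; tauto)) (hS.trans (.of_subset (by simp; tauto)))
  have drop : ∀ L : List Atom,
      C.HL (L ++ (.W (i + 1) :: U d t i ++ MsL (icc (ℓ + 1) (i + 1)))) =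
        C.HL (L ++ (.W (i + 1) :: U d t i)) := fun L => le_antisymm
    (HL_mono (.append_mono (.of_subset fun _ h => h) (.append (.of_subset fun _ h => h) hM)))
    (HL_mono (.append_mono (.of_subset fun _ h => h) (.of_subset (by simp; tauto))))
  have hnil := drop []
  simp only [List.nil_append] at hnil
  have e₁ := hsym.HL_U_succ hti hid (L := []) rfl
  have e₂ := hsym.HL_U_succ hti hid (L := SbarTo d (i + 2)) (by
    rw [SbarTo, Sto, List.map_map]
    refine List.map_congr_left fun k hk => ?_
    rw [mem_icc] at hk
    simp only [Function.comp, Atom.perm, rotDown_apply]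
    rw [if_neg (by omega), if_neg (by omega), if_neg (by omega), if_neg (by omega)])
  have e₃ : C.HL (U d (t + 1) (i + 2)) = C.HL (SbarTo d (i + 2) ++ U d (t + 1) (i + 1)) :=
    HL_congr fun a => by rw [mem_U_succ (by omega), List.mem_append]
  simp only [List.nil_append] at e₁
  rwa [drop, hnil, ← e₁, ← e₂, ← e₃] at hX

end Increment

theorem statement13 {Ω V : Type} [Fintype Ω] {d : ℕ} (hd : 2 ≤ d)
    {ℓ₁ ℓ₂ ℓ : ℕ} (hℓdef : ℓ = ℓ₁ + ℓ₂) (hℓd : ℓ < d)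
    (C : Code Ω V d) (hsym : C.Symmetrical) (hregen : C.NodeRegen)
    (hrec : C.MsgRecovery ℓ) (hsec : C.RepairSecrecy ℓ₁ ℓ₂)
    {m : ℕ} (hm : m ∈ Finset.Icc (ℓ + 1) (d - 1)) :
    C.HL (U d (ℓ₁ + 1) m) + ((d : ℝ) - (m : ℝ)) / ((d : ℝ) - (ℓ : ℝ)) * C.HL (U d ℓ₁ (ℓ + 1))
      ≥ ((d : ℝ) - (m : ℝ)) * (∑ j ∈ Finset.Icc (ℓ + 1) m, (T d j ℓ)⁻¹ * C.HL [Atom.M j])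
        + C.HL (U d (ℓ₁ + 1) (m + 1))
        + ((d : ℝ) - (m : ℝ)) / ((d : ℝ) - (ℓ : ℝ)) * C.HL (U d ℓ₁ ℓ) := by
  obtain ⟨hℓm, hmd⟩ := Finset.mem_Icc.1 hm
  obtain ⟨i, rfl⟩ : ∃ i, m = i + 1 := ⟨m - 1, by omega⟩
  subst hℓdef
  set ℓ := ℓ₁ + ℓ₂
  set h : ℕ → ℕ → ℝ := fun i q => C.HL (U d ℓ₁ i ++ MsL (icc (ℓ + 1) q)) with hh
  have hnil : MsL (icc (ℓ + 1) ℓ) = [] := by simp [MsL, icc]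
  have hE : ∀ q i, ℓ ≤ i → i + 1 < d → ((d : ℝ) - i) * (h (i + 2) q - h (i + 1) q) ≤
      ((d : ℝ) - i - 1) * (h (i + 1) q - h i q) := by
    intro q i hi hid
    have hsplit : h (i + 2) q =
        C.HL (SbarTo d (i + 2) ++ (U d ℓ₁ (i + 1) ++ MsL (icc (ℓ + 1) q))) :=
      Code.HL_congr fun a => by simp [mem_U_succ (show ℓ₁ ≤ i + 1 by omega), or_assoc]
    rw [hsplit]
    have hW : Code.Det C [.W (i + 1)] (U d ℓ₁ (i + 1)) :=
      Code.Det.trans (.of_subset (by simp [Ws, mem_icc])) (hregen.det_W (by omega))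
    refine hsym.exchange (by omega) (by omega) (icc (ℓ + 1) q)
      (.append_mono (.of_subset fun a ha => (mem_U_succ (by omega)).2 (.inr ha))
        (.of_subset fun _ ha => ha)) ?_
    exact (C.det_S_W (by simp; omega) (by simp; omega) (by omega)).trans
      (hW.trans (.of_subset (by simp +contextual)))
  have hB : ∀ k, ℓ ≤ k → k < d →
      C.HL [.M (k + 1)] + (h (k + 1) (k + 1) - h ℓ (k + 1)) ≤ h (k + 1) k - h ℓ k := by
    intro k hk hkd
    have hs := hsec.le_sub hk hkd
    have hr : h (k + 1) (k + 1) ≤ h (k + 1) k :=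
      Code.HL_mono ((Code.Det.of_subset (by simp +contextual)).append
        (((hrec.det_M hkd).trans (hregen.det_W (t := ℓ₁) (by omega))).trans
          (.of_subset (by simp +contextual))))
    simp only [hh] at hr ⊢
    linarith
  have hsum := sum_add_average_le (B := fun j => C.HL [.M j]) hE hB (by omega : ℓ ≤ i)
    (by omega)
  have hinc := T_mul_increment_le (g := fun k => h k (i + 1)) (hE (i + 1))
      (by omega : ℓ ≤ i) (by omega)
  have hfin : ((d : ℝ) - i) * (C.HL (U d (ℓ₁ + 1) (i + 2)) - C.HL (U d (ℓ₁ + 1) (i + 1))) ≤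
      ((d : ℝ) - i - 1) * (h (i + 1) (i + 1) - h i (i + 1)) :=
    hsym.HL_U_succ_increment_le hregen hrec (by omega) (by omega)
  have hℓ0 : h ℓ ℓ = C.HL (U d ℓ₁ ℓ) := by simp [hh, hnil]
  have hℓ1 : h (ℓ + 1) ℓ = C.HL (U d ℓ₁ (ℓ + 1)) := by simp [hh, hnil]
  rw [hℓ0, hℓ1] at hsum
  have hc : (0 : ℝ) < (d : ℝ) - i - 1 := by
    have : ((i + 1 : ℕ) : ℝ) < d := by exact_mod_cast (by omega : i + 1 < d)
    push_cast at this
    linarith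
  have hT := T_succ_pos (by omega : ℓ ≤ i) (by omega : i < d)
  have havg : (h (i + 1) (i + 1) - h i (i + 1)) / ((d : ℝ) - i) ≤
      (h (i + 1) (i + 1) - h ℓ (i + 1)) / T d (i + 1) ℓ := by
    rw [div_le_div_iff₀ (by linarith) hT, T_succ (by omega : ℓ ≤ i)]
    linarith
  have hlast : C.HL (U d (ℓ₁ + 1) (i + 2)) - C.HL (U d (ℓ₁ + 1) (i + 1)) ≤
      ((d : ℝ) - i - 1) * ((h (i + 1) (i + 1) - h i (i + 1)) / ((d : ℝ) - i)) := by
    rw [← mul_div_assoc, le_div_iff₀ (by linarith)]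
    linarith
  have hmul := mul_le_mul_of_nonneg_left (le_trans (add_le_add le_rfl havg) hsum) hc.le
  rw [mul_add] at hmul
  have hcast : (d : ℝ) - ((i + 1 : ℕ) : ℝ) = (d : ℝ) - i - 1 := by push_cast; ring
  have hdist : ((d : ℝ) - i - 1) * ((C.HL (U d ℓ₁ (ℓ + 1)) - C.HL (U d ℓ₁ ℓ)) / ((d : ℝ) - ℓ)) =
      ((d : ℝ) - i - 1) / ((d : ℝ) - ℓ) * C.HL (U d ℓ₁ (ℓ + 1)) -
        ((d : ℝ) - i - 1) / ((d : ℝ) - ℓ) * C.HL (U d ℓ₁ ℓ) := by ring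
  rw [hcast]
  linarith


end

end MDCSR
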